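/- There exists a constant N₁ > 0 such that for all p, q ∈ ℝ³: if |p−q| < (|p|+1)/2 then p₀q₀ − p·q − 1 ≥ N₁ |p−q|² / q₀², and if |p−q| ≥ (|p|+1)/2 then p₀q₀ − p·q − 1 ≥ N₁ p₀/q₀. -/

import Mathlib

/-!
STATEMENT 17: There exists a constant N₁ > 0 such that for all p, q ∈ ℝ³:
if |p−q| < (|p|+1)/2 then p₀q₀ − p·q − 1 ≥ N₁ |p−q|² / q₀², and
if |p−q| ≥ (|p|+1)/2 then p₀q₀ − p·q − 1 ≥ N₁ p₀/q₀,
where p₀ = (1+|p|²)^{1/2}, q₀ = (1+|q|²)^{1/2}.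
-/

noncomputable section
open Real
open scoped RealInnerProductSpace

abbrev E3 : Type := EuclideanSpace ℝ (Fin 3)

/-- `p₀ = (1 + |p|²)^{1/2}`. -/
def pzero (p : E3) : ℝ := Real.sqrt (1 + ‖p‖ ^ 2)

lemma pzero_sq (p : E3) : pzero p ^ 2 = 1 + ‖p‖ ^ 2 :=
  Real.sq_sqrt (by positivity)

lemma one_le_pzero (p : E3) : 1 ≤ pzero p :=
  Real.one_le_sqrt.2 (by nlinarith [sq_nonneg ‖p‖])

lemma norm_le_pzero (p : E3) : ‖p‖ ≤ pzero p :=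
  Real.le_sqrt_of_sq_le (by linarith)

lemma pzero_le_norm_add_one (p : E3) : pzero p ≤ ‖p‖ + 1 :=
  Real.sqrt_le_iff.2 ⟨by positivity, by nlinarith [norm_nonneg p]⟩

lemma inner_add_one_le_pzero_mul (p q : E3) : ⟪p, q⟫ + 1 ≤ pzero p * pzero q := by
  have hpq : ‖p‖ * ‖q‖ + 1 ≤ pzero p * pzero q := by
    refine abs_le_of_sq_le_sq' ?_ ?_ |>.2
    · rw [mul_pow, pzero_sq, pzero_sq]
      nlinarith [sq_nonneg (‖p‖ - ‖q‖)]
    · nlinarith [one_le_pzero p, one_le_pzero q]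
  linarith [real_inner_le_norm p q]

/-- The Lorentzian product controls the Euclidean distance. -/
lemma norm_sub_sq_le_lorentz (p q : E3) :
    ‖p - q‖ ^ 2 ≤ (pzero p * pzero q - ⟪p, q⟫ - 1) * (2 * (pzero p * pzero q)) := by
  have hle := inner_add_one_le_pzero_mul p q
  have hcs : ⟪p, q⟫ ^ 2 ≤ ‖p‖ ^ 2 * ‖q‖ ^ 2 := by
    rw [← mul_pow, ← sq_abs]
    exact pow_le_pow_left₀ (abs_nonneg _) (abs_real_inner_le_norm p q) 2
  have hsq : (pzero p * pzero q) ^ 2 = (1 + ‖p‖ ^ 2) * (1 + ‖q‖ ^ 2) := by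
    rw [mul_pow, pzero_sq, pzero_sq]
  rw [norm_sub_sq_real]
  nlinarith [sq_nonneg (pzero p * pzero q - ⟪p, q⟫ - 1)]

theorem stmt_17 :
    ∃ N₁ > (0 : ℝ), ∀ p q : E3,
      (‖p - q‖ < (‖p‖ + 1) / 2 →
        N₁ * ‖p - q‖ ^ 2 / (pzero q) ^ 2 ≤ pzero p * pzero q - ⟪p, q⟫ - 1) ∧
      ((‖p‖ + 1) / 2 ≤ ‖p - q‖ →
        N₁ * (pzero p / pzero q) ≤ pzero p * pzero q - ⟪p, q⟫ - 1) := by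
  refine ⟨1 / 8, by norm_num, fun p q => ?_⟩
  have ha := one_le_pzero p
  have hb := one_le_pzero q
  have ha' := pzero_le_norm_add_one p
  have hX := inner_add_one_le_pzero_mul p q
  have hd := norm_sub_sq_le_lorentz p q
  constructor
  · intro h
    have hab : pzero p ≤ 4 * pzero q := by
      linarith [norm_sub_norm_le p q, norm_le_pzero q]
    rw [div_le_iff₀ (by positivity)]
    have hmul := mul_le_mul_of_nonneg_left
      (mul_le_mul_of_nonneg_right hab (zero_le_one.trans hb)) (sub_nonneg.2 hX)
    linarith
  · intro h
    have had : pzero p ^ 2 ≤ (2 * ‖p - q‖) ^ 2 :=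
      pow_le_pow_left₀ (by linarith) (by linarith) 2
    rw [← mul_div_assoc, div_le_iff₀ (by linarith)]
    refine le_of_mul_le_mul_right ?_ (zero_lt_one.trans_le ha)
    linarith
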